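/- arXiv:2604.03223 — 7 statements merged into one kernel-verified Lean document; each statement's English description precedes it below -/
import Mathlib

section
/- Let r₀ ≥ 0 and let u : (r₀, ∞) → ℝ be a nonnegative, nondecreasing, differentiable function. Then for every δ > 0 there exists a measurable set E_δ ⊆ (r₀, ∞) of finite Lebesgue measure such that u'(r) ≤ u(r)^(1+δ) holds for every r ∈ (r₀, ∞) \ E_δ. (Borel's growth lemma.) -/
open MeasureTheory Set

/-- If `f` is monotone on a measurable set `s` with derivative `f'` there, and `f` maps `s` into
a bounded interval, then `f'` is at least `1` only on a subset of `s` of finite measure. -/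
theorem volume_one_le_deriv_lt_top {s : Set ℝ} (hs : MeasurableSet s) {f f' : ℝ → ℝ} {a b : ℝ}
    (hf : MonotoneOn f s) (hf' : ∀ x ∈ s, HasDerivAt f (f' x) x) (hab : MapsTo f s (Icc a b)) :
    volume (s ∩ {x | 1 ≤ f' x}) < ⊤ := by
  have hmeas : AEMeasurable (fun x => ENNReal.ofReal (f' x)) (volume.restrict s) :=
    (measurable_deriv f).ennreal_ofReal.aemeasurable.congr <|
      (ae_restrict_iff' hs).2 <| .of_forall fun x hx => by simp only [(hf' x hx).deriv]
  have hint : ∫⁻ x in s, ENNReal.ofReal (f' x) < ⊤ := by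
    rw [lintegral_deriv_eq_volume_image_of_monotoneOn hs
      (fun x hx => (hf' x hx).hasDerivWithinAt) hf]
    exact (measure_mono hab.image_subset).trans_lt measure_Icc_lt_top
  have hmarkov := mul_meas_ge_le_lintegral₀ hmeas 1
  rw [one_mul, Measure.restrict_apply' hs] at hmarkov
  refine (measure_mono ?_).trans_lt (hmarkov.trans_lt hint)
  rintro x ⟨hxs, hx⟩
  exact ⟨by simpa using hx, hxs⟩

/-- **Borel's growth lemma.** Let `r₀ ≥ 0` and let `u` be a nonnegative, nondecreasing,
differentiable function on `(r₀, ∞)` (with derivative `u'`). Then for every `δ > 0` there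
exists a measurable set `E ⊆ (r₀, ∞)` of finite Lebesgue measure such that
`u'(r) ≤ u(r)^(1+δ)` for every `r ∈ (r₀, ∞) \ E`. -/
theorem borel_growth_lemma (r₀ : ℝ) (hr₀ : 0 ≤ r₀) (u u' : ℝ → ℝ)
    (hu_nonneg : ∀ r ∈ Ioi r₀, 0 ≤ u r)
    (hu_mono : MonotoneOn u (Ioi r₀))
    (hu_deriv : ∀ r ∈ Ioi r₀, HasDerivAt u (u' r) r) :
    ∀ δ > (0 : ℝ), ∃ E : Set ℝ, E ⊆ Ioi r₀ ∧ MeasurableSet E ∧ volume E < ⊤ ∧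
      ∀ r ∈ Ioi r₀ \ E, u' r ≤ (u r) ^ (1 + δ) := by
  intro δ hδ
  set B : Set ℝ := {r | r ∈ Ioi r₀ ∧ u r ^ (1 + δ) < u' r}
  suffices hfin : volume B < ⊤ by
    refine ⟨toMeasurable volume B ∩ Ioi r₀, inter_subset_right,
      (measurableSet_toMeasurable _ _).inter measurableSet_Ioi,
      (measure_mono inter_subset_left).trans_lt (by rwa [measure_toMeasurable]), ?_⟩
    rintro r ⟨hr, hrE⟩
    by_contra! hlt
    exact hrE ⟨subset_toMeasurable _ _ ⟨hr, hlt⟩, hr⟩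
  by_cases hpos : ∃ r₁ ∈ Ioi r₀, 0 < u r₁
  · obtain ⟨r₁, hr₁, hur₁⟩ := hpos
    have hsub : Ioi r₁ ⊆ Ioi r₀ := Ioi_subset_Ioi (le_of_lt hr₁)
    have hle : ∀ r ∈ Ioi r₁, u r₁ ≤ u r := fun r hr => hu_mono hr₁ (hsub hr) (le_of_lt hr)
    have hupos : ∀ r ∈ Ioi r₁, 0 < u r := fun r hr => hur₁.trans_le (hle r hr)
    have htail : volume (Ioi r₁ ∩ {r | 1 ≤ u' r * u r ^ (-δ - 1)}) < ⊤ := by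
      refine volume_one_le_deriv_lt_top (f := fun r => -(u r ^ (-δ)) / δ)
        (a := -(u r₁ ^ (-δ)) / δ) (b := 0) measurableSet_Ioi ?_ ?_ ?_
      · intro x hx y hy hxy
        have := Real.rpow_le_rpow_of_nonpos (hupos x hx)
          (hu_mono (hsub hx) (hsub hy) hxy) (neg_nonpos.2 hδ.le)
        dsimp only
        gcongr
      · intro x hx
        have := (((hu_deriv x (hsub hx)).rpow_const (p := -δ)
          (Or.inl (hupos x hx).ne')).neg).div_const δ
        have heq : u' x * u x ^ (-δ - 1) = -(u' x * -δ * u x ^ (-δ - 1)) / δ := by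
          field_simp
        rw [heq]
        exact this
      · intro x hx
        have := Real.rpow_le_rpow_of_nonpos hur₁ (hle x hx) (neg_nonpos.2 hδ.le)
        refine ⟨by dsimp only; gcongr, ?_⟩
        have := Real.rpow_nonneg (hupos x hx).le (-δ)
        exact div_nonpos_of_nonpos_of_nonneg (by linarith) hδ.le
    refine (measure_mono ?_).trans_lt
      (measure_union_lt_top (measure_Ioc_lt_top (a := r₀) (b := r₁)) htail)
    rintro r ⟨hr, hlt⟩
    rcases le_or_gt r r₁ with h | h
    · exact Or.inl ⟨hr, h⟩
    · refine Or.inr ⟨h, ?_⟩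
      have hp := Real.rpow_pos_of_pos (hupos r h) (1 + δ)
      rw [mem_ofPred_eq, show -δ - 1 = -(1 + δ) by ring, Real.rpow_neg (hupos r h).le,
        ← div_eq_mul_inv, one_le_div hp]
      exact hlt.le
  · push Not at hpos
    have hempty : B = ∅ := by
      refine eq_empty_of_forall_notMem ?_
      rintro r ⟨hr, hlt⟩
      have hzero : ∀ x ∈ Ioi r₀, u x = 0 := fun x hx => (hpos x hx).antisymm (hu_nonneg x hx)
      have hev : u =ᶠ[nhds r] fun _ => 0 := by
        filter_upwards [Ioi_mem_nhds hr] with x hx using hzero x hx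
      have hd : u' r = 0 :=
        (hu_deriv r hr).unique ((hasDerivAt_const r (0 : ℝ)).congr_of_eventuallyEq hev)
      rw [hd] at hlt
      exact hlt.not_ge (Real.rpow_nonneg (hu_nonneg r hr) _)
    simp [hempty]
end

section
/- Let A > 0 be a constant, let V : (0,∞) → (0,∞) be continuous with ∫₀¹ s/V(s) ds < ∞, and let S : [0,∞) → [0,∞) be continuous. Define Λ(r) := A·∫₀^r (∫_t^r s/V(s) ds)·S(t) dt for r > 0. Then for every δ > 0 there exists a measurable set E_δ ⊆ (0,∞) of finite Lebesgue measure such that S(r) ≤ (1/A)·(V(r)/r)^(1+δ)·Λ(r)^((1+δ)²) holds for every r ∈ (0,∞) \ E_δ. (Real-analytic core of the non-parabolic Calculus Lemma.) -/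
open MeasureTheory Set intervalIntegral

/-- **Borel's growth lemma**: a positive function with nonnegative continuous derivative satisfies
`f' ≤ c * f ^ (1 + δ)` outside a set of finite measure. -/
theorem volume_setOf_mul_rpow_lt_deriv_lt_top {f f' : ℝ → ℝ} {a c δ : ℝ} (hc : 0 < c) (hδ : 0 < δ)
    (hf : ∀ x ∈ Ici a, HasDerivAt f (f' x) x) (hf' : ContinuousOn f' (Ici a))
    (hf'_nonneg : ∀ x ∈ Ici a, 0 ≤ f' x) (ha : 0 < f a) :
    volume {x ∈ Ioi a | c * f x ^ (1 + δ) < f' x} < ⊤ := by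
  have hcont : ContinuousOn f (Ici a) := fun x hx => (hf x hx).continuousAt.continuousWithinAt
  have hpos : ∀ x ∈ Ici a, 0 < f x := by
    have hmono : MonotoneOn f (Ici a) := by
      refine monotoneOn_of_hasDerivWithinAt_nonneg (f' := f') (convex_Ici a) hcont ?_ ?_
      · exact fun x hx => (hf x (interior_subset hx)).hasDerivWithinAt
      · exact fun x hx => hf'_nonneg x (interior_subset hx)
    exact fun x hx => ha.trans_le (hmono self_mem_Ici hx hx)
  set h : ℝ → ℝ := fun x => f' x * f x ^ (-δ - 1) with h_def
  have h_cont : ContinuousOn h (Ici a) :=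
    hf'.mul (hcont.rpow_const fun x hx => Or.inl (hpos x hx).ne')
  have h_nonneg : ∀ x ∈ Ici a, 0 ≤ h x := fun x hx =>
    mul_nonneg (hf'_nonneg x hx) (Real.rpow_nonneg (hpos x hx).le _)
  have h_int : IntegrableOn h (Ioi a) := by
    refine integrableOn_Ioi_of_intervalIntegral_norm_bounded (l := Filter.atTop)
      (b := fun x : ℝ => x) (f a ^ (-δ) / δ) a ?_ Filter.tendsto_id ?_
    · intro b
      exact ((h_cont.mono Icc_subset_Ici_self).integrableOn_Icc).mono_set Ioc_subset_Icc_self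
    · filter_upwards [Filter.eventually_ge_atTop a] with b hab
      have hsub : uIcc a b ⊆ Ici a := by
        rw [uIcc_of_le hab]
        exact Icc_subset_Ici_self
      have hnorm : ∫ x in a..b, ‖h x‖ = ∫ x in a..b, h x :=
        integral_congr fun x hx => Real.norm_of_nonneg (h_nonneg x (hsub hx))
      have hftc : ∫ x in a..b, h x = -(f b ^ (-δ) / δ) - -(f a ^ (-δ) / δ) := by
        refine integral_eq_sub_of_hasDerivAt (f := fun x => -(f x ^ (-δ) / δ)) (fun x hx => ?_)
          (h_cont.mono hsub).intervalIntegrable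
        have := (((hf x (hsub hx)).rpow_const (p := -δ)
          (Or.inl (hpos x (hsub hx)).ne')).div_const δ).fun_neg
        refine this.congr_deriv ?_
        simp only [h_def]
        field_simp
      rw [hnorm, hftc]
      have : 0 ≤ f b ^ (-δ) / δ := div_nonneg (Real.rpow_nonneg (hpos b hab).le _) hδ.le
      linarith
  have hlt := Integrable.measure_ge_lt_top h_int hc
  rw [Measure.restrict_apply₀' measurableSet_Ioi.nullMeasurableSet] at hlt
  refine (measure_mono ?_).trans_lt hlt
  rintro x ⟨hx, hlt'⟩
  have hx' : 0 < f x := hpos x (Ioi_subset_Ici_self hx)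
  refine ⟨?_, hx⟩
  calc c = c * f x ^ (1 + δ) * f x ^ (-δ - 1) := by
        rw [mul_assoc, ← Real.rpow_add hx', show 1 + δ + (-δ - 1) = 0 by ring, Real.rpow_zero,
          mul_one]
    _ ≤ h x := mul_le_mul_of_nonneg_right hlt'.le (Real.rpow_nonneg hx'.le _)

/-- Real-analytic core of the non-parabolic Calculus Lemma. -/
theorem calculus_lemma_nonparabolic (A : ℝ) (hA : 0 < A)
    (V : ℝ → ℝ) (hV_pos : ∀ s ∈ Ioi (0 : ℝ), 0 < V s)
    (hV_cont : ContinuousOn V (Ioi 0))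
    (hV_int : IntegrableOn (fun s => s / V s) (Ioc 0 1) volume)
    (S : ℝ → ℝ) (hS_nonneg : ∀ t ∈ Ici (0 : ℝ), 0 ≤ S t)
    (hS_cont : ContinuousOn S (Ici 0))
    (Λ : ℝ → ℝ)
    (hΛ : ∀ r > (0 : ℝ), Λ r = A * ∫ t in (0 : ℝ)..r, (∫ s in t..r, s / V s) * S t) :
    ∀ δ > (0 : ℝ), ∃ E : Set ℝ, E ⊆ Ioi 0 ∧ MeasurableSet E ∧ volume E < ⊤ ∧
      ∀ r ∈ Ioi (0 : ℝ) \ E,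
        S r ≤ (1 / A) * (V r / r) ^ (1 + δ) * (Λ r) ^ ((1 + δ) ^ 2) := by
  intro δ hδ
  suffices H : ∃ T : Set ℝ, volume T < ⊤ ∧ ∀ r ∈ Ioi (0 : ℝ) \ T,
      S r ≤ (1 / A) * (V r / r) ^ (1 + δ) * (Λ r) ^ ((1 + δ) ^ 2) by
    obtain ⟨T, hT, hle⟩ := H
    refine ⟨toMeasurable volume T ∩ Ioi 0, inter_subset_right,
      (measurableSet_toMeasurable _ _).inter measurableSet_Ioi,
      (measure_mono inter_subset_left).trans_lt (by rwa [measure_toMeasurable]), ?_⟩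
    exact fun r hr => hle r ⟨hr.1, fun h => hr.2 ⟨subset_toMeasurable _ _ h, hr.1⟩⟩
  set g : ℝ → ℝ := fun s => s / V s with g_def
  set G : ℝ → ℝ := fun r => ∫ s in (0 : ℝ)..r, g s
  set F : ℝ → ℝ := fun r => ∫ t in (0 : ℝ)..r, S t
  have g_cont : ContinuousOn g (Ioi 0) :=
    continuousOn_id.div hV_cont fun s hs => (hV_pos s hs).ne'
  have g_pos : ∀ s ∈ Ioi (0 : ℝ), 0 < g s := fun s hs => div_pos hs (hV_pos s hs)
  have g_int : ∀ r ∈ Ici (0 : ℝ), IntervalIntegrable g volume 0 r := by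
    intro r hr
    have h01 : IntervalIntegrable g volume 0 1 :=
      (intervalIntegrable_iff_integrableOn_Ioc_of_le zero_le_one).2 hV_int
    rcases le_total r 1 with h1 | h1
    · refine h01.mono_set ?_
      rw [uIcc_of_le hr, uIcc_of_le zero_le_one]
      exact Icc_subset_Icc_right h1
    · refine h01.trans (ContinuousOn.intervalIntegrable (g_cont.mono ?_))
      rw [uIcc_of_le h1]
      exact fun x hx => zero_lt_one.trans_le hx.1
  have S_int : ∀ r ∈ Ici (0 : ℝ), IntervalIntegrable S volume 0 r := by
    intro r hr
    refine ContinuousOn.intervalIntegrable (hS_cont.mono ?_)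
    rw [uIcc_of_le hr]
    exact Icc_subset_Ici_self
  have deriv_int : ∀ {u : ℝ → ℝ}, ContinuousOn u (Ioi 0) →
      (∀ r ∈ Ici (0 : ℝ), IntervalIntegrable u volume 0 r) → ∀ r ∈ Ioi (0 : ℝ),
      HasDerivAt (fun r => ∫ t in (0 : ℝ)..r, u t) (u r) r := fun hu hui r hr =>
    integral_hasDerivAt_right (hui r (Ioi_subset_Ici_self hr))
      (hu.stronglyMeasurableAtFilter isOpen_Ioi r hr) (hu.continuousAt (Ioi_mem_nhds hr))
  have hS_cont' : ContinuousOn S (Ioi 0) := hS_cont.mono Ioi_subset_Ici_self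
  have G_deriv : ∀ r ∈ Ioi (0 : ℝ), HasDerivAt G (g r) r := deriv_int g_cont g_int
  have F_deriv : ∀ r ∈ Ioi (0 : ℝ), HasDerivAt F (S r) r := deriv_int hS_cont' S_int
  have GS_int : ∀ r ∈ Ici (0 : ℝ), IntervalIntegrable (fun t => G t * S t) volume 0 r := by
    intro r hr
    refine (S_int r hr).continuousOn_mul ?_
    exact continuousOn_primitive_interval' (g_int r hr) left_mem_uIcc
  have G_cont : ContinuousOn G (Ioi 0) := fun r hr =>
    (G_deriv r hr).continuousAt.continuousWithinAt
  have F_cont : ContinuousOn F (Ioi 0) := fun r hr =>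
    (F_deriv r hr).continuousAt.continuousWithinAt
  have Λ_eq : ∀ r ∈ Ioi (0 : ℝ), Λ r = A * (G r * F r - ∫ t in (0 : ℝ)..r, G t * S t) := by
    intro r hr
    have hr0 : r ∈ Ici (0 : ℝ) := Ioi_subset_Ici_self hr
    have hGF : G r * F r = ∫ t in (0 : ℝ)..r, G r * S t :=
      (intervalIntegral.integral_const_mul _ _).symm
    rw [hΛ r hr, hGF, ← intervalIntegral.integral_sub ((S_int r hr0).const_mul _)
      (GS_int r hr0)]
    congr 1
    refine integral_congr fun t ht => ?_
    rw [uIcc_of_le hr0] at ht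
    rw [← integral_interval_sub_left (g_int r hr0) (g_int t ht.1)]
    exact sub_mul _ _ _
  have Λ_deriv : ∀ r ∈ Ioi (0 : ℝ), HasDerivAt Λ (A * (g r * F r)) r := by
    intro r hr
    have h := (((G_deriv r hr).mul (F_deriv r hr)).sub
      (deriv_int (G_cont.mul hS_cont') GS_int r hr)).const_mul A
    have h' := h.congr_of_eventuallyEq (f₁ := Λ)
      (by filter_upwards [Ioi_mem_nhds hr] with x hx using Λ_eq x hx)
    refine h'.congr_deriv ?_
    rw [Pi.mul_apply]
    ring
  have F_mono : MonotoneOn F (Ioi 0) := by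
    refine monotoneOn_of_hasDerivWithinAt_nonneg (f' := S) (convex_Ioi 0) F_cont ?_ ?_
    · exact fun x hx => (F_deriv x (interior_subset hx)).hasDerivWithinAt
    · exact fun x hx => hS_nonneg x (Ioi_subset_Ici_self (interior_subset hx))
  have F_nonneg : ∀ r ∈ Ioi (0 : ℝ), 0 ≤ F r := fun r hr =>
    integral_nonneg (le_of_lt hr) fun t ht => hS_nonneg t ht.1
  have Λ_nonneg : ∀ r ∈ Ioi (0 : ℝ), 0 ≤ Λ r := by
    intro r hr
    rw [hΛ r hr]
    refine mul_nonneg hA.le (integral_nonneg (le_of_lt hr) fun t ht =>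
      mul_nonneg (integral_nonneg ht.2 fun s hs => ?_) (hS_nonneg t ht.1))
    rcases (ht.1.trans hs.1).eq_or_lt with h0 | h0
    · simp [← h0]
    · exact (g_pos s h0).le
  by_cases hF : ∀ r ∈ Ioi (0 : ℝ), F r = 0
  · refine ⟨∅, by simp, fun r hr => ?_⟩
    have hr0 : r ∈ Ioi (0 : ℝ) := hr.1
    have hS0 : S r = 0 := by
      refine (F_deriv r hr0).unique ((hasDerivAt_const r (0 : ℝ)).congr_of_eventuallyEq ?_)
      filter_upwards [Ioi_mem_nhds hr0] with x hx using hF x hx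
    rw [hS0]
    exact mul_nonneg (mul_nonneg (one_div_nonneg.2 hA.le)
      (Real.rpow_nonneg (div_nonneg (hV_pos r hr0).le (le_of_lt hr0)) _))
      (Real.rpow_nonneg (Λ_nonneg r hr0) _)
  push Not at hF
  obtain ⟨r₀, hr₀, hFr₀⟩ := hF
  have hr₀' : 0 < r₀ := hr₀
  have F_pos : ∀ r ∈ Ici r₀, 0 < F r := fun r hr =>
    ((F_nonneg r₀ hr₀).lt_of_ne' hFr₀).trans_le (F_mono hr₀ (hr₀'.trans_le hr) hr)
  have Λ_deriv_pos : ∀ r ∈ Ici r₀, 0 < A * (g r * F r) := fun r hr =>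
    mul_pos hA (mul_pos (g_pos r (hr₀'.trans_le hr)) (F_pos r hr))
  set a : ℝ := r₀ + 1
  have ha : 0 < a := by positivity
  have ha_sub : Ici a ⊆ Ioi 0 := fun x hx => ha.trans_le hx
  have ha_sub' : Ici a ⊆ Ici r₀ := Ici_subset_Ici.2 (by linarith)
  have Λa_pos : 0 < Λ a := by
    have hmono : StrictMonoOn Λ (Ici r₀) := by
      refine strictMonoOn_of_hasDerivWithinAt_pos (f' := fun r => A * (g r * F r)) (convex_Ici r₀)
        ?_ ?_ ?_
      · exact fun x hx => (Λ_deriv x (hr₀'.trans_le hx)).continuousAt.continuousWithinAt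
      · exact fun x hx =>
          (Λ_deriv x (hr₀'.trans_le (interior_subset hx))).hasDerivWithinAt
      · exact fun x hx => Λ_deriv_pos x (interior_subset hx)
    exact (Λ_nonneg r₀ hr₀).trans_lt (hmono self_mem_Ici (ha_sub' self_mem_Ici) (by linarith))
  have hbadF : volume {x ∈ Ioi a | A ^ δ * F x ^ (1 + δ) < S x} < ⊤ :=
    volume_setOf_mul_rpow_lt_deriv_lt_top (Real.rpow_pos_of_pos hA δ) hδ
      (fun x hx => F_deriv x (ha_sub hx)) (hS_cont'.mono ha_sub)
      (fun x hx => hS_nonneg x (Ioi_subset_Ici_self (ha_sub hx))) (F_pos a (ha_sub' self_mem_Ici))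
  have hbadΛ : volume {x ∈ Ioi a | 1 * Λ x ^ (1 + δ) < A * (g x * F x)} < ⊤ :=
    volume_setOf_mul_rpow_lt_deriv_lt_top one_pos hδ
      (fun x hx => Λ_deriv x (ha_sub hx))
      ((continuousOn_const.mul (g_cont.mul F_cont)).mono ha_sub)
      (fun x hx => (Λ_deriv_pos x (ha_sub' hx)).le) Λa_pos
  refine ⟨Ioc 0 a ∪ ({x ∈ Ioi a | A ^ δ * F x ^ (1 + δ) < S x} ∪
    {x ∈ Ioi a | 1 * Λ x ^ (1 + δ) < A * (g x * F x)}),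
    measure_union_lt_top (by simp) (measure_union_lt_top hbadF hbadΛ), ?_⟩
  rintro r ⟨hr, hbad⟩
  have hr0 : 0 < r := hr
  simp only [mem_union, not_or, mem_Ioc, mem_ofPred_eq, not_and, not_lt, not_le, mem_Ioi,
    one_mul] at hbad
  obtain ⟨h1, h2, h3⟩ := hbad
  have har : a < r := h1 hr
  have hVr := hV_pos r hr
  have hF_le : F r ≤ V r / r * (1 / A) * Λ r ^ (1 + δ) := by
    have hF_eq : F r = V r / r * (1 / A) * (A * (g r * F r)) := by
      simp only [g_def]
      field_simp
    rw [hF_eq]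
    exact mul_le_mul_of_nonneg_left (h3 har) (by positivity)
  have hΛr := Λ_nonneg r hr
  calc S r ≤ A ^ δ * F r ^ (1 + δ) := h2 har
    _ ≤ A ^ δ * (V r / r * (1 / A) * Λ r ^ (1 + δ)) ^ (1 + δ) := by
        have := F_nonneg r hr
        gcongr
    _ = A ^ δ * (1 / A) ^ (1 + δ) * (V r / r) ^ (1 + δ) * Λ r ^ ((1 + δ) ^ 2) := by
        rw [Real.mul_rpow (by positivity) (by positivity), Real.mul_rpow (by positivity)
          (by positivity), ← Real.rpow_mul hΛr]
        ring_nf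
    _ = (1 / A) * (V r / r) ^ (1 + δ) * Λ r ^ ((1 + δ) ^ 2) := by
        congr 2
        rw [Real.rpow_add (by positivity), Real.rpow_one, Real.div_rpow zero_le_one hA.le,
          Real.one_rpow]
        have := Real.rpow_pos_of_pos hA δ
        field_simp
end

section
/- Let m ≥ 1 and 0 < ε < 1, and let V : (0,∞) → (0,∞) satisfy V(√r)/V(√t) ≤ (r/t)^m for all 0 < t ≤ r. Then the constant C := ∫₀¹ exp(−1/(4(1+ε)t))·t^(−m−1/2) dt is finite, and for every r ≥ 1 one has ∫₀^r (1/V(√t))·exp(−r²/(4(1+ε)t))·t^(−1/2) dt ≤ (r^m/V(√r))·(r + C). -/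
open MeasureTheory Set intervalIntegral

/-- The function `t ↦ exp (-a / t) * t ^ (-p)` is bounded on `(0, ∞)`. -/
theorem exp_neg_div_mul_rpow_neg_le {a p t : ℝ} (ha : 0 < a) (hp : 0 < p) (ht : 0 < t) :
    Real.exp (-(a / t)) * t ^ (-p) ≤ (p / a) ^ p := by
  have hx : 0 < a / t := div_pos ha ht
  have h : a / t ≤ p * Real.exp (a / t / p) := by
    have := Real.add_one_le_exp (a / t / p)
    rw [mul_comm, ← div_le_iff₀ hp]
    linarith
  have h' : (a / t) ^ p ≤ p ^ p * Real.exp (a / t) := by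
    calc (a / t) ^ p ≤ (p * Real.exp (a / t / p)) ^ p :=
          Real.rpow_le_rpow hx.le h hp.le
      _ = p ^ p * Real.exp (a / t) := by
          rw [Real.mul_rpow hp.le (Real.exp_pos _).le, ← Real.exp_mul, div_mul_cancel₀ _ hp.ne']
  rw [Real.div_rpow ha.le ht.le] at h'
  rw [Real.div_rpow hp.le ha.le, Real.rpow_neg ht.le, Real.exp_neg, ← mul_inv,
    le_div_iff₀ (Real.rpow_pos_of_pos ha p), inv_mul_le_iff₀ (by positivity)]
  rw [div_le_iff₀ (Real.rpow_pos_of_pos ht p)] at h'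
  linarith

/-- The function `t ↦ exp (-a / t) * t ^ (-p)` is integrable on `(0, 1]`. -/
theorem integrableOn_exp_neg_div_mul_rpow_neg {a p : ℝ} (ha : 0 < a) (hp : 0 < p) :
    IntegrableOn (fun t : ℝ => Real.exp (-(a / t)) * t ^ (-p)) (Ioc 0 1) volume := by
  refine Measure.integrableOn_of_bounded (M := (p / a) ^ p) (by simp) ?_ ?_
  · exact Measurable.aestronglyMeasurable (by fun_prop)
  · filter_upwards [ae_restrict_mem measurableSet_Ioc] with t ht
    have ht0 : 0 < t := ht.1
    rw [Real.norm_of_nonneg (by positivity)]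
    exact exp_neg_div_mul_rpow_neg_le ha hp ht0

/-- Upper estimate of the numerator integral of `F(r,δ)`: the constant
`C = ∫₀¹ exp(−1/(4(1+ε)t))·t^(−m−1/2) dt` is finite, and for `r ≥ 1` one has
`∫₀^r (1/V(√t))·exp(−r²/(4(1+ε)t))·t^(−1/2) dt ≤ (r^m/V(√r))·(r + C)`. -/
theorem numerator_upper_estimate (ε m : ℝ) (hε₀ : 0 < ε) (hε₁ : ε < 1) (hm : 1 ≤ m)
    (V : ℝ → ℝ) (hV_pos : ∀ s ∈ Ioi (0 : ℝ), 0 < V s)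
    (hV_ratio : ∀ t r : ℝ, 0 < t → t ≤ r →
      V (Real.sqrt r) / V (Real.sqrt t) ≤ (r / t) ^ m) :
    IntegrableOn (fun t : ℝ => Real.exp (-1 / (4 * (1 + ε) * t)) * t ^ (-m - 1 / 2))
      (Ioc 0 1) volume ∧
    ∀ r : ℝ, 1 ≤ r →
      (∫ t in (0 : ℝ)..r,
          (1 / V (Real.sqrt t)) * Real.exp (-(r ^ 2) / (4 * (1 + ε) * t)) * t ^ (-(1 : ℝ) / 2))
        ≤ (r ^ m / V (Real.sqrt r)) *
            (r + ∫ t in (0 : ℝ)..1, Real.exp (-1 / (4 * (1 + ε) * t)) * t ^ (-m - 1 / 2)) := by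
  have hε : 0 < 1 + ε := by linarith
  have hint : IntegrableOn
      (fun t : ℝ => Real.exp (-1 / (4 * (1 + ε) * t)) * t ^ (-m - 1 / 2)) (Ioc 0 1) volume := by
    have h := integrableOn_exp_neg_div_mul_rpow_neg (a := 1 / (4 * (1 + ε))) (p := m + 1 / 2)
      (by positivity) (by linarith)
    simpa only [div_div, ← neg_div, neg_add'] using h
  refine ⟨hint, fun r hr => ?_⟩
  have hr0 : 0 < r := by linarith
  have hVr : 0 < V (Real.sqrt r) := hV_pos _ (Real.sqrt_pos.2 hr0)
  set g : ℝ → ℝ := fun t => Real.exp (-1 / (4 * (1 + ε) * t)) * t ^ (-m - 1 / 2) with hg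
  have hind : IntegrableOn ((Ioc 0 1).indicator g) (Ioc 0 r) volume :=
    (hint.integrable_indicator measurableSet_Ioc).integrableOn
  have hone : IntegrableOn (fun _ : ℝ => (1 : ℝ)) (Ioc 0 r) volume := by simp
  have hval : (∫ t in Ioc 0 r, (r ^ m / V (Real.sqrt r)) * ((Ioc 0 1).indicator g t + 1)) =
      (r ^ m / V (Real.sqrt r)) * (r + ∫ t in (0 : ℝ)..1, g t) := by
    rw [MeasureTheory.integral_const_mul, MeasureTheory.integral_add hind hone,
      setIntegral_indicator measurableSet_Ioc,
      inter_eq_self_of_subset_right (Ioc_subset_Ioc_right hr),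
      intervalIntegral.integral_of_le zero_le_one]
    simp [hr0.le, add_comm]
  rw [← hval, intervalIntegral.integral_of_le hr0.le]
  refine integral_mono_of_nonneg ?_ ((hind.add hone).const_mul _) ?_
  · filter_upwards [ae_restrict_mem measurableSet_Ioc] with t ht
    have ht0 : 0 < t := ht.1
    have := hV_pos _ (Real.sqrt_pos.2 ht0)
    simp only [Pi.zero_apply]
    positivity
  · filter_upwards [ae_restrict_mem measurableSet_Ioc] with t ht
    have ht0 : 0 < t := ht.1
    have hVt : 0 < V (Real.sqrt t) := hV_pos _ (Real.sqrt_pos.2 ht0)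
    have hV : 1 / V (Real.sqrt t) ≤ r ^ m / V (Real.sqrt r) * t ^ (-m) := by
      have h := hV_ratio t r ht0 ht.2
      rw [Real.div_rpow hr0.le ht0.le] at h
      rw [Real.rpow_neg ht0.le]
      calc 1 / V (Real.sqrt t) = V (Real.sqrt r) / V (Real.sqrt t) / V (Real.sqrt r) := by
            field_simp
        _ ≤ r ^ m / t ^ m / V (Real.sqrt r) := by gcongr
        _ = r ^ m / V (Real.sqrt r) * (t ^ m)⁻¹ := by ring
    have hE : Real.exp (-(r ^ 2) / (4 * (1 + ε) * t)) * t ^ (-m - 1 / 2) ≤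
        (Ioc 0 1).indicator g t + 1 := by
      by_cases h1 : t ≤ 1
      · rw [indicator_of_mem (show t ∈ Ioc (0 : ℝ) 1 from ⟨ht0, h1⟩)]
        have : Real.exp (-(r ^ 2) / (4 * (1 + ε) * t)) ≤ Real.exp (-1 / (4 * (1 + ε) * t)) := by
          gcongr
          nlinarith
        have := mul_le_mul_of_nonneg_right this (Real.rpow_nonneg ht0.le (-m - 1 / 2))
        simp only [hg]
        linarith
      · rw [indicator_of_notMem (fun h => h1 h.2), zero_add]
        refine mul_le_one₀ (Real.exp_le_one_iff.2 ?_) (by positivity)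
          (Real.rpow_le_one_of_one_le_of_nonpos (not_le.1 h1).le (by linarith))
        exact div_nonpos_of_nonpos_of_nonneg (by nlinarith) (by positivity)
    calc 1 / V (Real.sqrt t) * Real.exp (-(r ^ 2) / (4 * (1 + ε) * t)) * t ^ (-(1 : ℝ) / 2)
        ≤ r ^ m / V (Real.sqrt r) * t ^ (-m) * Real.exp (-(r ^ 2) / (4 * (1 + ε) * t)) *
            t ^ (-(1 : ℝ) / 2) := by gcongr
      _ = r ^ m / V (Real.sqrt r) *
            (Real.exp (-(r ^ 2) / (4 * (1 + ε) * t)) * t ^ (-m - 1 / 2)) := by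
          rw [show -m - 1 / 2 = -m + -(1 : ℝ) / 2 by ring, Real.rpow_add ht0]
          ring
      _ ≤ r ^ m / V (Real.sqrt r) * ((Ioc 0 1).indicator g t + 1) := by gcongr
end

section
/- Let 0 < ε < 1, δ > 0, c₁ > 0, c₂ > 0 and m ≥ 1, and let V : (0,∞) → (0,∞) be nondecreasing and satisfy V(√r)/V(√t) ≤ (r/t)^m for all 0 < t ≤ r. Define F(r,δ) := (c₂(1−ε)/c₁)·[∫₀^r (1/V(√t))·exp(−r²/(4(1+ε)t))·t^(−1/2) dt] / [r·∫₀^r (1/V(√t))·exp(−r²/(4(1−ε)t))·t^(−1) dt]^(1+δ). Then there exists a constant K > 0 such that log⁺ F(r,δ) ≤ K·r for all r ≥ 1. -/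
open MeasureTheory Set intervalIntegral

/-- `log⁺ x = max (log x) 0` (equal to `0` for `x ≤ 0`, since `Real.log` vanishes there). -/
noncomputable def logPlus (x : ℝ) : ℝ := max (Real.log x) 0

lemma logPlus_le_of_le_mul_exp {x B L r : ℝ} (hB : 0 < B) (hL : 0 ≤ L) (hr : 1 ≤ r)
    (hx₀ : 0 ≤ x) (hx : x ≤ B * Real.exp (L * r)) :
    logPlus x ≤ (|Real.log B| + L) * r := by
  have h0 : 0 ≤ (|Real.log B| + L) * r := by positivity
  refine max_le ?_ h0
  rcases hx₀.eq_or_lt with rfl | hpos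
  · simpa using h0
  · have h := Real.log_le_log hpos hx
    rw [Real.log_mul hB.ne' (Real.exp_pos _).ne', Real.log_exp] at h
    nlinarith [le_abs_self (Real.log B), abs_nonneg (Real.log B)]

lemma rpow_le_mul_exp {m x y : ℝ} (hm : 0 < m) (hy : 0 ≤ y) (hyx : y ≤ 8 * x) :
    y ^ m ≤ (8 * m) ^ m * Real.exp x := by
  have h1 : y ≤ 8 * m * Real.exp (x / m) := by
    have h := Real.add_one_le_exp (x / m)
    have h2 : x = m * (x / m) := by field_simp
    have h3 : m * (x / m) ≤ m * Real.exp (x / m) := by gcongr; linarith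
    linarith
  calc y ^ m ≤ (8 * m * Real.exp (x / m)) ^ m := Real.rpow_le_rpow hy h1 hm.le
    _ = (8 * m) ^ m * Real.exp x := by
      rw [Real.mul_rpow (by positivity) (Real.exp_pos _).le, ← Real.exp_mul,
        div_mul_cancel₀ _ hm.ne']

/-- Upper bound for the weighted heat-kernel integral with the weight `t ^ (-1 / 2)`. -/
lemma integral_rpow_neg_half_le {ε m r : ℝ} (hε₀ : 0 < ε) (hε₁ : ε < 1) (hm : 0 < m)
    (hr : 1 ≤ r) {V : ℝ → ℝ} (hV_pos : ∀ s ∈ Ioi (0 : ℝ), 0 < V s)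
    (hV_ratio : ∀ t r : ℝ, 0 < t → t ≤ r →
      V (Real.sqrt r) / V (Real.sqrt t) ≤ (r / t) ^ m) :
    (∫ t in (0 : ℝ)..r,
      (1 / V (Real.sqrt t)) * Real.exp (-(r ^ 2) / (4 * (1 + ε) * t)) * t ^ (-(1 : ℝ) / 2))
      ≤ 2 * (8 * m) ^ m * r / V (Real.sqrt r) := by
  have hr0 : 0 < r := by linarith
  have hW : 0 < V (Real.sqrt r) := hV_pos _ (Real.sqrt_pos.2 hr0)
  have hbound : ∀ t ∈ Ioc (0 : ℝ) r,
      ‖(1 / V (Real.sqrt t)) * Real.exp (-(r ^ 2) / (4 * (1 + ε) * t)) * t ^ (-(1 : ℝ) / 2)‖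
        ≤ (8 * m) ^ m / V (Real.sqrt r) * t ^ (-(1 : ℝ) / 2) := by
    rintro t ⟨ht, htr⟩
    have hVt : 0 < V (Real.sqrt t) := hV_pos _ (Real.sqrt_pos.2 ht)
    rw [Real.norm_of_nonneg (by positivity)]
    gcongr
    have hy : r / t ≤ 8 * (r ^ 2 / (4 * (1 + ε) * t)) := by
      rw [← mul_div_assoc, div_le_div_iff₀ ht (by positivity)]
      have h1 : (1 + ε) ≤ 2 * r := by linarith
      have h2 : 0 < 4 * r * t := by positivity
      nlinarith
    have h := (hV_ratio t r ht htr).trans (rpow_le_mul_exp hm (by positivity) hy)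
    rw [neg_div, Real.exp_neg, le_div_iff₀ hW, mul_comm, ← mul_assoc, mul_one_div,
      ← div_eq_mul_inv, div_le_iff₀ (Real.exp_pos _)]
    exact h
  have hint : IntervalIntegrable
      (fun t : ℝ => (8 * m) ^ m / V (Real.sqrt r) * t ^ (-(1 : ℝ) / 2)) volume 0 r :=
    (intervalIntegral.intervalIntegrable_rpow' (by norm_num)).const_mul _
  have h := intervalIntegral.norm_integral_le_of_norm_le hr0.le
    (Filter.Eventually.of_forall hbound) hint
  refine (Real.le_norm_self _).trans (h.trans ?_)
  rw [intervalIntegral.integral_const_mul, integral_rpow (Or.inl (by norm_num))]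
  have h1 : r ^ (-(1 : ℝ) / 2 + 1) ≤ r :=
    (Real.rpow_le_rpow_of_exponent_le hr (by norm_num)).trans_eq (Real.rpow_one r)
  rw [Real.zero_rpow (by norm_num), sub_zero]
  calc (8 * m) ^ m / V (Real.sqrt r) * (r ^ (-(1 : ℝ) / 2 + 1) / (-(1 : ℝ) / 2 + 1))
      ≤ (8 * m) ^ m / V (Real.sqrt r) * (r / (-(1 : ℝ) / 2 + 1)) := by
        gcongr
    _ = 2 * (8 * m) ^ m * r / V (Real.sqrt r) := by ring

/-- Lower bound for the weighted heat-kernel integral with the weight `t⁻¹`. -/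
lemma le_mul_integral_inv {ε r : ℝ} (hε₁ : ε < 1) (hr : 1 ≤ r)
    {V : ℝ → ℝ} (hV_pos : ∀ s ∈ Ioi (0 : ℝ), 0 < V s) (hV_mono : MonotoneOn V (Ioi 0))
    (hint : IntervalIntegrable (fun t : ℝ =>
      (1 / V (Real.sqrt t)) * Real.exp (-(r ^ 2) / (4 * (1 - ε) * t)) * t⁻¹) volume 0 r) :
    Real.exp (-(r / (2 * (1 - ε)))) / (2 * V (Real.sqrt r)) ≤
      r * ∫ t in (0 : ℝ)..r,
        (1 / V (Real.sqrt t)) * Real.exp (-(r ^ 2) / (4 * (1 - ε) * t)) * t⁻¹ := by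
  have hr0 : 0 < r := by linarith
  have he : 0 < 1 - ε := by linarith
  have hW : 0 < V (Real.sqrt r) := hV_pos _ (Real.sqrt_pos.2 hr0)
  set c : ℝ := 1 / V (Real.sqrt r) * Real.exp (-(r / (2 * (1 - ε)))) * r⁻¹ with hc
  have hle : ∀ t ∈ Icc (r / 2) r, c ≤
      (1 / V (Real.sqrt t)) * Real.exp (-(r ^ 2) / (4 * (1 - ε) * t)) * t⁻¹ := by
    rintro t ⟨ht, htr⟩
    have ht0 : 0 < t := by linarith
    have hVt : 0 < V (Real.sqrt t) := hV_pos _ (Real.sqrt_pos.2 ht0)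
    have hVle : V (Real.sqrt t) ≤ V (Real.sqrt r) :=
      hV_mono (Real.sqrt_pos.2 ht0) (Real.sqrt_pos.2 hr0) (Real.sqrt_le_sqrt htr)
    have hexp : -(r / (2 * (1 - ε))) ≤ -(r ^ 2) / (4 * (1 - ε) * t) := by
      rw [neg_div, neg_le_neg_iff, div_le_div_iff₀ (by positivity) (by positivity)]
      have : 0 < r * (1 - ε) := by positivity
      nlinarith
    rw [hc]
    gcongr
  have hsub : IntervalIntegrable (fun t : ℝ =>
      (1 / V (Real.sqrt t)) * Real.exp (-(r ^ 2) / (4 * (1 - ε) * t)) * t⁻¹) volume (r / 2) r :=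
    hint.mono_set (by
      rw [uIcc_of_le hr0.le, uIcc_of_le (by linarith)]
      exact Icc_subset_Icc (by linarith) le_rfl)
  have h1 := intervalIntegral.integral_mono_on (μ := volume) (by linarith : r / 2 ≤ r)
    (intervalIntegrable_const (c := c)) hsub hle
  have h2 := intervalIntegral.integral_mono_interval (μ := volume) (by linarith : (0 : ℝ) ≤ r / 2)
    (by linarith : r / 2 ≤ r) le_rfl
    ((ae_restrict_mem measurableSet_Ioc).mono fun t ht => by
      have hVt : 0 < V (Real.sqrt t) := hV_pos _ (Real.sqrt_pos.2 ht.1)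
      have ht0 : 0 < t := ht.1
      simp only [Pi.zero_apply]
      positivity) hint
  rw [intervalIntegral.integral_const, smul_eq_mul] at h1
  calc Real.exp (-(r / (2 * (1 - ε)))) / (2 * V (Real.sqrt r))
      = (r - r / 2) * c := by rw [hc]; field_simp; norm_num
    _ ≤ 1 * ∫ t in (0 : ℝ)..r,
        (1 / V (Real.sqrt t)) * Real.exp (-(r ^ 2) / (4 * (1 - ε) * t)) * t⁻¹ := by
        rw [one_mul]; exact h1.trans h2
    _ ≤ _ := by
      refine mul_le_mul_of_nonneg_right hr (le_trans ?_ (h1.trans h2))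
      have : 0 ≤ r - r / 2 := by linarith
      positivity

/-- The function `F(r,δ)` from the parabolic Calculus Lemma satisfies
`log⁺ F(r,δ) ≤ K·r` for all `r ≥ 1`. -/
theorem logPlus_F_linear_bound (ε δ c₁ c₂ m : ℝ)
    (hε₀ : 0 < ε) (hε₁ : ε < 1) (hδ : 0 < δ) (hc₁ : 0 < c₁) (hc₂ : 0 < c₂) (hm : 1 ≤ m)
    (V : ℝ → ℝ) (hV_pos : ∀ s ∈ Ioi (0 : ℝ), 0 < V s)
    (hV_mono : MonotoneOn V (Ioi 0))
    (hV_ratio : ∀ t r : ℝ, 0 < t → t ≤ r →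
      V (Real.sqrt r) / V (Real.sqrt t) ≤ (r / t) ^ m)
    (F : ℝ → ℝ)
    (hF : ∀ r : ℝ, F r = (c₂ * (1 - ε) / c₁) *
      (∫ t in (0 : ℝ)..r,
          (1 / V (Real.sqrt t)) * Real.exp (-(r ^ 2) / (4 * (1 + ε) * t)) * t ^ (-(1 : ℝ) / 2))
        / (r * ∫ t in (0 : ℝ)..r,
            (1 / V (Real.sqrt t)) * Real.exp (-(r ^ 2) / (4 * (1 - ε) * t)) * t⁻¹)
          ^ (1 + δ)) :
    ∃ K > (0 : ℝ), ∀ r : ℝ, 1 ≤ r → logPlus (F r) ≤ K * r := by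
  have he : 0 < 1 - ε := by linarith
  have hm0 : 0 < m := by linarith
  have hV1 : 0 < V 1 := hV_pos 1 (mem_Ioi.2 one_pos)
  set A : ℝ := c₂ * (1 - ε) / c₁ with hA
  have hA0 : 0 < A := by positivity
  set a : ℝ := 1 / (2 * (1 - ε)) with ha
  have ha0 : 0 < a := by positivity
  set B : ℝ := A * (2 * (8 * m) ^ m) * (2 ^ (1 + δ) * V 1 ^ δ) with hB
  have hB0 : 0 < B := by positivity
  set L : ℝ := 1 + m * δ + a * (1 + δ) with hL
  have hL0 : 0 < L := by positivity
  refine ⟨|Real.log B| + L, by positivity, fun r hr => ?_⟩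
  have hr0 : 0 < r := by linarith
  have hW : 0 < V (Real.sqrt r) := hV_pos _ (Real.sqrt_pos.2 hr0)
  rw [hF r]
  by_cases hint : IntervalIntegrable (fun t : ℝ =>
      (1 / V (Real.sqrt t)) * Real.exp (-(r ^ 2) / (4 * (1 - ε) * t)) * t⁻¹) volume 0 r
  swap
  · rw [intervalIntegral.integral_undef hint, mul_zero, Real.zero_rpow (by linarith), div_zero]
    simp only [logPlus, Real.log_zero, max_self]
    positivity
  have hN := integral_rpow_neg_half_le hε₀ hε₁ hm0 hr hV_pos hV_ratio
  have hN0 : 0 ≤ ∫ t in (0 : ℝ)..r,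
      (1 / V (Real.sqrt t)) * Real.exp (-(r ^ 2) / (4 * (1 + ε) * t)) * t ^ (-(1 : ℝ) / 2) := by
    rw [intervalIntegral.integral_of_le hr0.le]
    refine setIntegral_nonneg measurableSet_Ioc fun t ht => ?_
    have hVt : 0 < V (Real.sqrt t) := hV_pos _ (Real.sqrt_pos.2 ht.1)
    have ht0 : 0 < t := ht.1
    positivity
  have hD := le_mul_integral_inv hε₁ hr hV_pos hV_mono hint
  generalize (∫ t in (0 : ℝ)..r,
      (1 / V (Real.sqrt t)) * Real.exp (-(r ^ 2) / (4 * (1 + ε) * t)) * t ^ (-(1 : ℝ) / 2)) = N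
    at hN hN0 ⊢
  generalize (r * ∫ t in (0 : ℝ)..r,
      (1 / V (Real.sqrt t)) * Real.exp (-(r ^ 2) / (4 * (1 - ε) * t)) * t⁻¹) = D at hD ⊢
  set W : ℝ := V (Real.sqrt r) with hWdef
  have hD0 : 0 < D := lt_of_lt_of_le (by positivity) hD
  refine logPlus_le_of_le_mul_exp hB0 hL0.le hr (by positivity) ?_
  have hrexp : r ≤ Real.exp r := by linarith [Real.add_one_le_exp r]
  have hWle : W ≤ V 1 * Real.exp (m * r) := by
    have h := hV_ratio 1 r one_pos hr
    rw [Real.sqrt_one, div_one, div_le_iff₀ hV1] at h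
    have h2 : r ^ m ≤ Real.exp (m * r) := by
      rw [mul_comm m r, Real.exp_mul]
      exact Real.rpow_le_rpow hr0.le hrexp hm0.le
    calc W ≤ r ^ m * V 1 := h
      _ ≤ Real.exp (m * r) * V 1 := by gcongr
      _ = V 1 * Real.exp (m * r) := mul_comm _ _
  have hWδ : W ^ δ ≤ V 1 ^ δ * Real.exp (m * δ * r) := by
    refine (Real.rpow_le_rpow hW.le hWle hδ.le).trans_eq ?_
    rw [Real.mul_rpow hV1.le (Real.exp_pos _).le, ← Real.exp_mul]
    ring_nf
  have hDinv : (D ^ (1 + δ))⁻¹ ≤ 2 ^ (1 + δ) * (W * W ^ δ) * Real.exp (a * (1 + δ) * r) := by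
    rw [← Real.inv_rpow hD0.le]
    have h : D⁻¹ ≤ 2 * W * Real.exp (a * r) := by
      refine (inv_anti₀ (by positivity) hD).trans_eq ?_
      rw [inv_div, Real.exp_neg, div_inv_eq_mul, ha, one_div_mul_eq_div]
    refine (Real.rpow_le_rpow (by positivity) h (by positivity)).trans_eq ?_
    rw [Real.mul_rpow (by positivity) (Real.exp_pos _).le, Real.mul_rpow (by norm_num) hW.le,
      Real.rpow_add hW, Real.rpow_one, ← Real.exp_mul]
    ring_nf
  calc A * N / D ^ (1 + δ) = A * N * (D ^ (1 + δ))⁻¹ := div_eq_mul_inv _ _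
    _ ≤ A * (2 * (8 * m) ^ m * r / W) *
        (2 ^ (1 + δ) * (W * W ^ δ) * Real.exp (a * (1 + δ) * r)) := by gcongr
    _ = A * (2 * (8 * m) ^ m) * (2 ^ (1 + δ) * W ^ δ) * (r * Real.exp (a * (1 + δ) * r)) := by
        field_simp
    _ ≤ A * (2 * (8 * m) ^ m) * (2 ^ (1 + δ) * (V 1 ^ δ * Real.exp (m * δ * r))) *
        (Real.exp r * Real.exp (a * (1 + δ) * r)) := by gcongr
    _ = B * (Real.exp r * Real.exp (m * δ * r) * Real.exp (a * (1 + δ) * r)) := by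
        rw [hB]; ring
    _ = B * Real.exp (L * r) := by
        rw [← Real.exp_add, ← Real.exp_add, hL]; ring_nf
end

section
/- Let 0 < ε < 1 and c₁, c₂ > 0, and let V : (0,∞) → (0,∞) be continuous and satisfy V(√s) ≥ c·s^m for all s ∈ (0,1], for some constants c > 0 and m ≥ 1. Then there exists r₀ > 0, depending only on ε, c₁ and c₂, such that for every r ≥ r₀ and every ρ ≥ ((1+ε)/(1−ε))·r one has (c₂/c₁)·∫₀^r (1/V(√t))·exp(−ρ²/(4(1+ε)t)) dt < ∫₀^r (1/V(√t))·exp(−r²/(4(1−ε)t)) dt. (Real-analytic core of the theorem locating ∂Δ(r) inside the annulus r ≤ ρ(x) ≤ ((1+ε)/(1−ε))r.) -/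
open MeasureTheory Set intervalIntegral

/-- If `V (√s)` is bounded below by a multiple of a power of `s` near zero, then the factor
`exp (-A / (B * t))` makes `1 / V (√t)` integrable up to zero. -/
lemma intervalIntegrable_one_div_mul_exp {V : ℝ → ℝ} {c m A B r : ℝ}
    (hV : ∀ s ∈ Ioi (0 : ℝ), 0 < V s) (hVc : ContinuousOn V (Ioi 0)) (hc : 0 < c)
    (hVm : ∀ s ∈ Ioc (0 : ℝ) 1, c * s ^ m ≤ V (Real.sqrt s))
    (hA : 0 < A) (hB : 0 < B) (hr : 0 < r) :
    IntervalIntegrable (fun t => (1 / V (Real.sqrt t)) * Real.exp (-A / (B * t)))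
      volume 0 r := by
  have hcont : ContinuousOn (fun t => (1 / V (Real.sqrt t)) * Real.exp (-A / (B * t)))
      (Ioi 0) := by
    have hsqrt : ContinuousOn (fun t => V (Real.sqrt t)) (Ioi 0) :=
      hVc.comp Real.continuous_sqrt.continuousOn fun t ht => Real.sqrt_pos.2 ht
    refine (continuousOn_const.div hsqrt fun t ht => (hV _ (Real.sqrt_pos.2 ht)).ne').mul ?_
    refine Real.continuous_exp.comp_continuousOn
      (continuousOn_const.div (by fun_prop) fun t ht => ?_)
    exact (mul_pos hB (mem_Ioi.1 ht)).ne'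
  have hone : IntervalIntegrable
      (fun t => (1 / V (Real.sqrt t)) * Real.exp (-A / (B * t))) volume 0 1 := by
    rw [intervalIntegrable_iff_integrableOn_Ioc_of_le zero_le_one]
    obtain ⟨k, hk⟩ := exists_nat_ge m
    refine IntegrableOn.of_bound (by simp)
      ((hcont.mono Ioc_subset_Ioi_self).aestronglyMeasurable measurableSet_Ioc)
      (k.factorial / (c * (A / B) ^ k)) ?_
    filter_upwards [ae_restrict_mem measurableSet_Ioc] with t ht
    have hVt := hV _ (Real.sqrt_pos.2 ht.1)
    have hpow : t ^ k ≤ t ^ m := by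
      rw [← Real.rpow_natCast]
      exact Real.rpow_le_rpow_of_exponent_ge ht.1 ht.2 hk
    have hlow : c * t ^ k ≤ V (Real.sqrt t) :=
      (mul_le_mul_of_nonneg_left hpow hc.le).trans (hVm t ht)
    have ht0 := ht.1
    have hexp := Real.pow_div_factorial_le_exp (A / (B * t)) (by positivity) k
    have hkf : (0 : ℝ) < k.factorial := by exact_mod_cast k.factorial_pos
    have hab : (A / (B * t)) ^ k * t ^ k = (A / B) ^ k := by
      rw [← mul_pow]
      congr 1
      field_simp
    rw [Real.norm_of_nonneg (by positivity), neg_div, Real.exp_neg, one_div, ← mul_inv,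
      ← inv_div (c * (A / B) ^ k)]
    refine inv_anti₀ (by positivity) ?_
    calc c * (A / B) ^ k / k.factorial
        = c * t ^ k * ((A / (B * t)) ^ k / k.factorial) := by rw [← hab]; ring
      _ ≤ V (Real.sqrt t) * Real.exp (A / (B * t)) := by gcongr
  refine hone.trans (hcont.mono fun t ht => ?_).intervalIntegrable
  exact (lt_min one_pos hr).trans_le ht.1

/-- Real-analytic core of the theorem locating `∂Δ(r)` inside the annulus
`r ≤ ρ(x) ≤ ((1+ε)/(1−ε))·r`: there is a threshold `r₀` depending only on `ε, c₁, c₂`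
(in particular, independent of `V`, `c`, `m`) beyond which the stated strict inequality
between the two integrals holds. -/
theorem annulus_location (ε c₁ c₂ : ℝ) (hε₀ : 0 < ε) (hε₁ : ε < 1)
    (hc₁ : 0 < c₁) (hc₂ : 0 < c₂) :
    ∃ r₀ > (0 : ℝ), ∀ V : ℝ → ℝ, ∀ c m : ℝ,
      (∀ s ∈ Ioi (0 : ℝ), 0 < V s) → ContinuousOn V (Ioi 0) →
      0 < c → 1 ≤ m → (∀ s ∈ Ioc (0 : ℝ) 1, c * s ^ m ≤ V (Real.sqrt s)) →
      ∀ r : ℝ, r₀ ≤ r → ∀ ρ : ℝ, ((1 + ε) / (1 - ε)) * r ≤ ρ →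
        (c₂ / c₁) * ∫ t in (0 : ℝ)..r,
            (1 / V (Real.sqrt t)) * Real.exp (-(ρ ^ 2) / (4 * (1 + ε) * t))
          < ∫ t in (0 : ℝ)..r,
              (1 / V (Real.sqrt t)) * Real.exp (-(r ^ 2) / (4 * (1 - ε) * t)) := by
  have h1 : 0 < 1 - ε := by linarith
  have hK : 0 < c₂ / c₁ := by positivity
  set K := c₂ / c₁
  refine ⟨K * (2 * (1 - ε) ^ 2 / ε), by positivity, ?_⟩
  intro V c m hV hVc hc _ hVm r hr ρ hρ
  have hr0 : 0 < r := lt_of_lt_of_le (by positivity) hr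
  have hρ0 : 0 < ρ := lt_of_lt_of_le (by positivity) hρ
  have hf := (intervalIntegrable_one_div_mul_exp (A := ρ ^ 2) (B := 4 * (1 + ε)) hV hVc hc hVm
    (by positivity) (by positivity) hr0).const_mul K
  have hg := intervalIntegrable_one_div_mul_exp (A := r ^ 2) (B := 4 * (1 - ε)) hV hVc hc hVm
    (by positivity) (by positivity) hr0
  rw [← sub_pos, ← intervalIntegral.integral_const_mul, ← intervalIntegral.integral_sub hg hf]
  refine intervalIntegral_pos_of_pos_on (hg.sub hf) (fun t ht => ?_) hr0
  have ht0 := ht.1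
  have hVt := hV _ (Real.sqrt_pos.2 ht0)
  have hsq : ((1 + ε) / (1 - ε) * r) ^ 2 ≤ ρ ^ 2 := by gcongr
  have hgap : K ≤ ρ ^ 2 / (4 * (1 + ε) * t) - r ^ 2 / (4 * (1 - ε) * t) :=
    calc K ≤ r * (ε / (2 * (1 - ε) ^ 2)) := by
          rw [← inv_div, ← div_eq_mul_inv, le_div_iff₀ (by positivity)]
          exact hr
      _ ≤ r * (r / t) * (ε / (2 * (1 - ε) ^ 2)) := by
          gcongr
          exact le_mul_of_one_le_right hr0.le ((one_le_div ht0).2 ht.2.le)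
      _ = ((1 + ε) / (1 - ε) * r) ^ 2 / (4 * (1 + ε) * t) - r ^ 2 / (4 * (1 - ε) * t) := by
          field_simp
          ring
      _ ≤ _ := by gcongr
  have hexp : K * Real.exp (-ρ ^ 2 / (4 * (1 + ε) * t))
      < Real.exp (-r ^ 2 / (4 * (1 - ε) * t)) :=
    calc K * Real.exp (-ρ ^ 2 / (4 * (1 + ε) * t))
        < Real.exp K * Real.exp (-ρ ^ 2 / (4 * (1 + ε) * t)) := by
          gcongr
          linarith [Real.add_one_le_exp K]
      _ ≤ _ := by
          rw [← Real.exp_add, Real.exp_le_exp, neg_div, neg_div]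
          linarith
  have := mul_lt_mul_of_pos_left hexp (one_div_pos.2 hVt)
  simp only [sub_pos]
  linarith
end

section
/- Let 0 < ε < 1 and set θ := 2(1+ε)/(1−ε). Let V : (0,∞) → (0,∞) be continuous, nondecreasing, and satisfy V(√s) ≥ c·s^m for all s ∈ (0,1] for some constants c > 0 and m ≥ 1. Then for every r ≥ 1 and every ρ with 0 < ρ ≤ θr/2 one has ∫₀^{θr} (1/V(√s))·(exp(−ρ²/(4(1−ε)s)) − exp(−θ²r²/(4(1−ε)s))) ds ≥ (1 − exp(−3/(16(1−ε))))·(r/(2V(√r)))·exp(−θ²r/(8(1−ε))). (Real-analytic core of the lower bound for h_{θr}(o,x) on Δ(r).) -/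
open MeasureTheory Set intervalIntegral

/-- The Gaussian factor `exp (-A / (K * s))` beats every power of `s` at the origin. -/
theorem exp_neg_div_le_mul_rpow {A K m : ℝ} (hA : 0 < A) (hK : 0 < K) :
    ∃ C : ℝ, 0 < C ∧ ∀ s ∈ Ioc (0 : ℝ) 1, Real.exp (-A / (K * s)) ≤ C * s ^ m := by
  obtain ⟨n, hn⟩ := exists_nat_ge m
  refine ⟨n.factorial / (A / K) ^ n, by positivity, fun s hs => ?_⟩
  have hs0 : 0 < s := hs.1
  have h1 := Real.pow_div_factorial_le_exp (A / K / s) (by positivity) n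
  have h2 : s ^ n ≤ s ^ m := by
    rw [← Real.rpow_natCast]
    exact Real.rpow_le_rpow_of_exponent_ge hs0 hs.2 hn
  have h3 : -A / (K * s) = -(A / K / s) := by field_simp
  rw [h3, Real.exp_neg]
  calc (Real.exp (A / K / s))⁻¹ ≤ ((A / K / s) ^ n / n.factorial)⁻¹ :=
        inv_anti₀ (by positivity) h1
    _ = n.factorial / (A / K) ^ n * s ^ n := by
        rw [div_pow, inv_div, div_div_eq_mul_div, mul_div_right_comm]
    _ ≤ _ := by gcongr

theorem exp_neg_div_le_exp_neg_div {A B K s : ℝ} (hAB : A ≤ B) (hK : 0 < K) (hs : 0 < s) :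
    Real.exp (-B / (K * s)) ≤ Real.exp (-A / (K * s)) := by
  gcongr

/-- A difference of Gaussian factors, weighted by `1 / V (√s)`, is integrable up to the origin
as soon as `V (√s)` has a power lower bound there. -/
theorem integrableOn_one_div_mul_exp_sub_exp {V : ℝ → ℝ} (hV_pos : ∀ s ∈ Ioi (0 : ℝ), 0 < V s)
    (hV_cont : ContinuousOn V (Ioi 0)) (hV_mono : MonotoneOn V (Ioi 0))
    {c m : ℝ} (hc : 0 < c) (hV_lb : ∀ s ∈ Ioc (0 : ℝ) 1, c * s ^ m ≤ V (Real.sqrt s))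
    {A B K : ℝ} (hA : 0 < A) (hAB : A ≤ B) (hK : 0 < K) (R : ℝ) :
    IntegrableOn (fun s => (1 / V (Real.sqrt s)) *
      (Real.exp (-A / (K * s)) - Real.exp (-B / (K * s)))) (Ioc 0 R) := by
  obtain ⟨C, hC, hCs⟩ := exp_neg_div_le_mul_rpow (m := m) hA hK
  have hV1 : 0 < V 1 := hV_pos 1 (mem_Ioi.2 one_pos)
  have hsqrt : MapsTo Real.sqrt (Ioc 0 R) (Ioi 0) := fun s hs => Real.sqrt_pos.2 hs.1
  have hcont : ContinuousOn (fun s => (1 / V (Real.sqrt s)) *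
      (Real.exp (-A / (K * s)) - Real.exp (-B / (K * s)))) (Ioc 0 R) := by
    have hexp : ∀ D : ℝ, ContinuousOn (fun s => Real.exp (-D / (K * s))) (Ioc 0 R) := fun D =>
      (continuousOn_const.div (by fun_prop) fun s hs => (mul_pos hK hs.1).ne').rexp
    exact (continuousOn_const.div (hV_cont.comp Real.continuous_sqrt.continuousOn hsqrt)
      fun s hs => (hV_pos _ (hsqrt hs)).ne').mul ((hexp A).sub (hexp B))
  refine IntegrableOn.of_bound (by simp) (hcont.aestronglyMeasurable measurableSet_Ioc)
    (max (C / c) (1 / V 1)) ?_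
  refine (ae_restrict_iff' measurableSet_Ioc).2 (ae_of_all _ fun s hs => ?_)
  have hs0 : 0 < s := hs.1
  have hV : 0 < V (Real.sqrt s) := hV_pos _ (hsqrt hs)
  have hBA := exp_neg_div_le_exp_neg_div hAB hK hs0
  rw [Real.norm_of_nonneg (mul_nonneg (by positivity) (sub_nonneg.2 hBA))]
  have hle : (1 / V (Real.sqrt s)) * (Real.exp (-A / (K * s)) - Real.exp (-B / (K * s)))
      ≤ Real.exp (-A / (K * s)) / V (Real.sqrt s) := by
    rw [one_div_mul_eq_div]
    gcongr
    linarith [Real.exp_pos (-B / (K * s))]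
  refine hle.trans ?_
  rcases le_total s 1 with h | h
  · refine le_max_of_le_left ?_
    have hpow : 0 < s ^ m := Real.rpow_pos_of_pos hs0 m
    calc Real.exp (-A / (K * s)) / V (Real.sqrt s) ≤ C * s ^ m / (c * s ^ m) := by
          gcongr
          · exact hCs s ⟨hs0, h⟩
          · exact hV_lb s ⟨hs0, h⟩
      _ = C / c := by field_simp
  · refine le_max_of_le_right ?_
    gcongr
    · refine Real.exp_le_one_iff.2 (div_nonpos_of_nonpos_of_nonneg ?_ ?_)
      · linarith
      · positivity
    · exact hV_mono (mem_Ioi.2 one_pos) (hsqrt hs) (Real.one_le_sqrt.2 h)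

/-- Lower bound for a difference of Gaussian factors at times comparable to `r`. -/
theorem exp_sub_exp_lower_bound {k θ r ρ s : ℝ} (hk : 0 < k) (hθ : 1 ≤ θ) (hr : 1 ≤ r)
    (hρ₀ : 0 ≤ ρ) (hρ : ρ ≤ θ * r / 2) (hs : s ∈ Icc (r / 2) r) :
    (1 - Real.exp (-3 / (16 * k))) * Real.exp (-θ ^ 2 * r / (8 * k)) ≤
      Real.exp (-(ρ ^ 2) / (4 * k * s)) - Real.exp (-(θ * r) ^ 2 / (4 * k * s)) := by
  have hr0 : 0 < r := by linarith
  have hs0 : 0 < s := by linarith [hs.1]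
  have h1 : Real.exp (-((θ * r / 2) ^ 2) / (4 * k * s)) ≤ Real.exp (-(ρ ^ 2) / (4 * k * s)) := by
    gcongr
  have h2 : -(θ * r) ^ 2 / (4 * k * s) =
      -((θ * r / 2) ^ 2) / (4 * k * s) + -(3 * θ ^ 2 * r ^ 2) / (16 * k * s) := by
    field_simp
    ring
  have h3 : -θ ^ 2 * r / (8 * k) ≤ -((θ * r / 2) ^ 2) / (4 * k * s) := by
    rw [div_le_div_iff₀ (by positivity) (by positivity)]
    nlinarith [mul_nonneg (by positivity : 0 ≤ θ ^ 2 * r * k) (by linarith [hs.1] : 0 ≤ 2 * s - r)]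
  have h4 : -(3 * θ ^ 2 * r ^ 2) / (16 * k * s) ≤ -3 / (16 * k) := by
    have hsr : s ≤ θ ^ 2 * r ^ 2 := by
      nlinarith [hs.2, one_le_pow₀ (n := 2) hθ, mul_nonneg hr0.le (sub_nonneg.2 hr)]
    rw [div_le_div_iff₀ (by positivity) (by positivity)]
    nlinarith [mul_nonneg hk.le (sub_nonneg.2 hsr)]
  have h5 : Real.exp (-3 / (16 * k)) ≤ 1 :=
    Real.exp_le_one_iff.2 (div_nonpos_of_nonpos_of_nonneg (by norm_num) (by positivity))
  calc (1 - Real.exp (-3 / (16 * k))) * Real.exp (-θ ^ 2 * r / (8 * k))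
      ≤ (1 - Real.exp (-(3 * θ ^ 2 * r ^ 2) / (16 * k * s))) *
          Real.exp (-((θ * r / 2) ^ 2) / (4 * k * s)) := by
        refine mul_le_mul ?_ (Real.exp_le_exp.2 h3) (Real.exp_pos _).le ?_
        · linarith [Real.exp_le_exp.2 h4]
        · linarith [Real.exp_le_exp.2 h4]
    _ = Real.exp (-((θ * r / 2) ^ 2) / (4 * k * s)) - Real.exp (-(θ * r) ^ 2 / (4 * k * s)) := by
        rw [h2, Real.exp_add]
        ring
    _ ≤ _ := by linarith

/-- Real-analytic core of the lower bound for `h_{θr}(o,x)` on `Δ(r)`, where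
`θ = 2(1+ε)/(1−ε)`. -/
theorem h_lower_bound_core (ε : ℝ) (hε₀ : 0 < ε) (hε₁ : ε < 1)
    (V : ℝ → ℝ) (hV_pos : ∀ s ∈ Ioi (0 : ℝ), 0 < V s)
    (hV_cont : ContinuousOn V (Ioi 0)) (hV_mono : MonotoneOn V (Ioi 0))
    (c m : ℝ) (hc : 0 < c) (hm : 1 ≤ m)
    (hV_lb : ∀ s ∈ Ioc (0 : ℝ) 1, c * s ^ m ≤ V (Real.sqrt s)) :
    ∀ r : ℝ, 1 ≤ r → ∀ ρ : ℝ, 0 < ρ → ρ ≤ (2 * (1 + ε) / (1 - ε)) * r / 2 →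
      (1 - Real.exp (-3 / (16 * (1 - ε)))) * (r / (2 * V (Real.sqrt r))) *
          Real.exp (-(2 * (1 + ε) / (1 - ε)) ^ 2 * r / (8 * (1 - ε)))
        ≤ ∫ s in (0 : ℝ)..(2 * (1 + ε) / (1 - ε)) * r,
            (1 / V (Real.sqrt s)) *
              (Real.exp (-(ρ ^ 2) / (4 * (1 - ε) * s)) -
                Real.exp (-((2 * (1 + ε) / (1 - ε)) * r) ^ 2 / (4 * (1 - ε) * s))) := by
  intro r hr ρ hρ₀ hρ
  have hk : 0 < 1 - ε := by linarith
  have hθ : 1 ≤ 2 * (1 + ε) / (1 - ε) := by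
    rw [le_div_iff₀ hk]
    linarith
  generalize 2 * (1 + ε) / (1 - ε) = θ at hθ hρ ⊢
  generalize 1 - ε = k at hk ⊢
  have hr0 : 0 < r := by linarith
  have hrθ : r ≤ θ * r := le_mul_of_one_le_left hr0.le hθ
  have hsq : ρ ^ 2 ≤ (θ * r) ^ 2 := by
    gcongr
    linarith
  have hK : 0 < 4 * k := by positivity
  have hint : IntervalIntegrable (fun s => (1 / V (Real.sqrt s)) *
      (Real.exp (-(ρ ^ 2) / (4 * k * s)) - Real.exp (-(θ * r) ^ 2 / (4 * k * s))))
      volume 0 (θ * r) :=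
    (intervalIntegrable_iff_integrableOn_Ioc_of_le (by linarith)).2
      (integrableOn_one_div_mul_exp_sub_exp hV_pos hV_cont hV_mono hc hV_lb (by positivity)
        hsq hK _)
  have hVr : 0 < V (Real.sqrt r) := hV_pos _ (Real.sqrt_pos.2 hr0)
  have hVs : ∀ s : ℝ, 0 < s → 0 < V (Real.sqrt s) := fun s hs => hV_pos _ (Real.sqrt_pos.2 hs)
  calc (1 - Real.exp (-3 / (16 * k))) * (r / (2 * V (Real.sqrt r))) *
        Real.exp (-θ ^ 2 * r / (8 * k))
      = ∫ _ in (r / 2)..r, (1 / V (Real.sqrt r)) *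
          ((1 - Real.exp (-3 / (16 * k))) * Real.exp (-θ ^ 2 * r / (8 * k))) := by
        rw [intervalIntegral.integral_const, smul_eq_mul]
        field_simp
        ring
    _ ≤ ∫ s in (r / 2)..r, (1 / V (Real.sqrt s)) *
          (Real.exp (-(ρ ^ 2) / (4 * k * s)) - Real.exp (-(θ * r) ^ 2 / (4 * k * s))) := by
        refine intervalIntegral.integral_mono_on (by linarith) intervalIntegrable_const
          (hint.mono_set ?_) fun s hs => ?_
        · rw [uIcc_of_le (by linarith), uIcc_of_le (by linarith)]
          exact Icc_subset_Icc (by linarith) hrθ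
        · have hs0 : 0 < s := by linarith [hs.1]
          have hV := hVs s hs0
          refine mul_le_mul ?_ (exp_sub_exp_lower_bound hk hθ hr hρ₀.le hρ hs) ?_ (by positivity)
          · exact one_div_le_one_div_of_le hV (hV_mono (Real.sqrt_pos.2 hs0)
              (Real.sqrt_pos.2 hr0) (Real.sqrt_le_sqrt hs.2))
          · refine mul_nonneg (sub_nonneg.2 (Real.exp_le_one_iff.2 ?_)) (Real.exp_pos _).le
            exact div_nonpos_of_nonpos_of_nonneg (by norm_num) (by positivity)
    _ ≤ _ := by
        refine intervalIntegral.integral_mono_interval (by linarith) (by linarith) hrθ ?_ hint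
        refine (ae_restrict_iff' measurableSet_Ioc).2 (ae_of_all _ fun s hs => ?_)
        exact mul_nonneg (one_div_nonneg.2 (hVs s hs.1).le)
          (sub_nonneg.2 (exp_neg_div_le_exp_neg_div hsq hK hs.1))
end

section
/- Let (X, μ) be a measure space with 0 < μ(X) ≤ 1, let n ≥ 1 be a real number, and let ξ : X → (0,∞) be measurable such that ξ^(1/n) is μ-integrable and log ξ is μ-integrable. Then ∫_X log ξ dμ ≤ n·log⁺(∫_X ξ^(1/n) dμ) + n/e. (Jensen-type inequality for sub-probability measures used in the proof of the parabolic Second Main Theorem.) -/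
open MeasureTheory Set

theorem le_exp_logPlus (x : ℝ) : x ≤ Real.exp (logPlus x) :=
  (Real.le_exp_log x).trans (Real.exp_le_exp.2 (le_max_left _ _))

/-- The function `-m log m` is bounded by its maximum `1 / e`. -/
theorem neg_mul_log_le_inv_exp_one {m : ℝ} (hm : 0 < m) :
    -(m * Real.log m) ≤ 1 / Real.exp 1 := by
  have h := Real.log_le_sub_one_of_pos (x := 1 / (m * Real.exp 1)) (by positivity)
  rw [one_div, Real.log_inv, Real.log_mul hm.ne' (Real.exp_ne_zero 1), Real.log_exp] at h
  have h' : -Real.log m ≤ (m * Real.exp 1)⁻¹ := by linarith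
  calc -(m * Real.log m) = m * -Real.log m := by ring
    _ ≤ m * (m * Real.exp 1)⁻¹ := by gcongr
    _ = 1 / Real.exp 1 := by field_simp

/-- The graph of `log` lies below its tangent line at `c`. -/
theorem log_le_log_add_div_sub_one {c t : ℝ} (hc : 0 < c) (ht : 0 < t) :
    Real.log t ≤ Real.log c - 1 + t / c := by
  have h := Real.log_le_sub_one_of_pos (div_pos ht hc)
  rw [Real.log_div ht.ne' hc.ne'] at h
  linarith

/-- Jensen-type inequality for sub-probability measures used in the proof of the
parabolic Second Main Theorem: if `0 < μ(X) ≤ 1`, `n ≥ 1`, and `ξ > 0` with `ξ^(1/n)`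
and `log ξ` integrable, then `∫ log ξ dμ ≤ n·log⁺(∫ ξ^(1/n) dμ) + n/e`. -/
theorem jensen_subprobability {X : Type*} [MeasurableSpace X] (μ : Measure X)
    (hμ_pos : 0 < μ univ) (hμ_le : μ univ ≤ 1)
    (n : ℝ) (hn : 1 ≤ n)
    (ξ : X → ℝ) (hξ_meas : Measurable ξ) (hξ_pos : ∀ x, 0 < ξ x)
    (h_int_pow : Integrable (fun x => ξ x ^ ((1 : ℝ) / n)) μ)
    (h_int_log : Integrable (fun x => Real.log (ξ x)) μ) :
    ∫ x, Real.log (ξ x) ∂μ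
      ≤ n * logPlus (∫ x, ξ x ^ ((1 : ℝ) / n) ∂μ) + n / Real.exp 1 := by
  have hn0 : 0 < n := by linarith
  have hfin : IsFiniteMeasure μ := ⟨hμ_le.trans_lt ENNReal.one_lt_top⟩
  set m : ℝ := μ.real univ
  have hm : 0 < m := ENNReal.toReal_pos hμ_pos.ne' (measure_ne_top μ univ)
  have hm1 : m ≤ 1 := ENNReal.toReal_le_of_le_ofReal zero_le_one (by simpa using hμ_le)
  set I : ℝ := ∫ x, ξ x ^ ((1 : ℝ) / n) ∂μ
  set L : ℝ := logPlus I
  have hL0 : 0 ≤ L := le_max_right _ _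
  set c : ℝ := Real.exp L / m with hc_def
  have hc : 0 < c := by positivity
  have hlogc : Real.log c = L - Real.log m := by
    rw [hc_def, Real.log_div (Real.exp_ne_zero L) hm.ne', Real.log_exp]
  have hIc : I / c ≤ m := by
    rw [div_le_iff₀ hc, hc_def, mul_div_cancel₀ _ hm.ne']
    exact le_exp_logPlus I
  have hpt (x : X) : Real.log (ξ x) ≤ n * (Real.log c - 1 + ξ x ^ ((1 : ℝ) / n) / c) := by
    have h := log_le_log_add_div_sub_one hc (Real.rpow_pos_of_pos (hξ_pos x) (1 / n))
    calc Real.log (ξ x) = n * Real.log (ξ x ^ ((1 : ℝ) / n)) := by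
          rw [Real.log_rpow (hξ_pos x)]
          field_simp
      _ ≤ _ := by gcongr
  have hint : Integrable (fun x => Real.log c - 1 + ξ x ^ ((1 : ℝ) / n) / c) μ :=
    (integrable_const _).add (h_int_pow.div_const c)
  calc ∫ x, Real.log (ξ x) ∂μ
      ≤ ∫ x, n * (Real.log c - 1 + ξ x ^ ((1 : ℝ) / n) / c) ∂μ :=
        integral_mono h_int_log (hint.const_mul n) hpt
    _ = n * (m * (Real.log c - 1) + I / c) := by
        rw [integral_const_mul, integral_add (integrable_const _) (h_int_pow.div_const c),
          integral_const, integral_div, smul_eq_mul]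
    _ ≤ n * (L + 1 / Real.exp 1) := by
        refine mul_le_mul_of_nonneg_left ?_ hn0.le
        rw [hlogc]
        nlinarith [neg_mul_log_le_inv_exp_one hm, mul_le_mul_of_nonneg_right hm1 hL0]
    _ = n * L + n / Real.exp 1 := by ring
end
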